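/- Let R be a commutative noetherian ring and F a flat R-module. Then F is cotorsion if and only if F is pure injective. -/

import Mathlib

universe u

open TensorProduct

/-- A pure monomorphism of `R`-modules: an injective `R`-linear map `f : A → B` such that
for every `R`-module `Q` the induced map `Q ⊗[R] A → Q ⊗[R] B` is injective. -/
def IsPureMono {R : Type u} [CommRing R] {A B : Type u}
    [AddCommGroup A] [AddCommGroup B] [Module R A] [Module R B]
    (f : A →ₗ[R] B) : Prop :=
  Function.Injective f ∧
    ∀ (Q : Type u) [AddCommGroup Q] [Module R Q],
      Function.Injective (LinearMap.lTensor Q f)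

/-- An `R`-module `P` is pure injective if every `R`-linear map `A → P` extends along
every pure monomorphism `A → B`. -/
def IsPureInjective (R : Type u) [CommRing R] (P : Type u)
    [AddCommGroup P] [Module R P] : Prop :=
  ∀ ⦃A B : Type u⦄ [AddCommGroup A] [AddCommGroup B] [Module R A] [Module R B]
    (f : A →ₗ[R] B), IsPureMono f → ∀ g : A →ₗ[R] P, ∃ h : B →ₗ[R] P, h ∘ₗ f = g

/-- An `R`-module `M` is absolutely pure if every injective `R`-linear map with domain `M`
is a pure monomorphism. -/
def IsAbsolutelyPure (R : Type u) [CommRing R] (M : Type u)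
    [AddCommGroup M] [Module R M] : Prop :=
  ∀ (N : Type u) [AddCommGroup N] [Module R N] (f : M →ₗ[R] N),
    Function.Injective f → IsPureMono f

/-- An `R`-module `C` is cotorsion if every short exact sequence `0 → C → G → F' → 0`
with flat `F'` splits. -/
def IsCotorsion (R : Type u) [CommRing R] (C : Type u)
    [AddCommGroup C] [Module R C] : Prop :=
  ∀ (G : Type u) [AddCommGroup G] [Module R G] (i : C →ₗ[R] G),
    Function.Injective i → Module.Flat R (G ⧸ LinearMap.range i) →
      ∃ r : G →ₗ[R] C, r ∘ₗ i = LinearMap.id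

/-- The canonical evaluation map from a module to its double character module. -/
def evalCharacterHom (R : Type u) [CommRing R] (M : Type u)
    [AddCommGroup M] [Module R M] :
    M →ₗ[R] CharacterModule (CharacterModule M) where
  toFun m :=
    { toFun := fun φ => φ m
      map_zero' := rfl
      map_add' := fun _ _ => rfl }
  map_add' m n := by ext φ; exact map_add φ m n
  map_smul' r m := by
    ext φ
    show φ (r • m) = (r • φ) m
    rw [CharacterModule.smul_apply]

namespace CharacterModule

/-- A character of `A` vanishing on the kernel of `f : A → B` factors through `f`. -/
theorem exists_dual_eq_of_ker_le {R A B : Type*} [CommRing R] [AddCommGroup A] [AddCommGroup B]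
    [Module R A] [Module R B] (f : A →ₗ[R] B) (c : CharacterModule A)
    (hc : ∀ a, f a = 0 → c a = 0) : ∃ d : CharacterModule B, dual f d = c := by
  let c' : CharacterModule (A ⧸ LinearMap.ker f) :=
    QuotientAddGroup.lift (LinearMap.ker f).toAddSubgroup c fun a ha ↦ hc a ha
  have hinj : Function.Injective ((LinearMap.ker f).liftQ f le_rfl) :=
    LinearMap.ker_eq_bot.mp (Submodule.ker_liftQ_eq_bot _ _ _ le_rfl)
  obtain ⟨d, hd⟩ := dual_surjective_of_injective _ hinj c'
  exact ⟨d, DFunLike.ext _ _ fun a ↦ congr($hd (Submodule.Quotient.mk a))⟩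

/-- The character module of an injective module over a noetherian ring is flat. -/
theorem flat_of_baer {R E : Type*} [CommRing R] [IsNoetherianRing R] [AddCommGroup E]
    [Module R E] (hE : Module.Baer R E) : Module.Flat R (CharacterModule E) := by
  refine Module.Flat.of_forall_isTrivialRelation fun {l f x} hx ↦ ?_
  let φ : (Fin l → R) →ₗ[R] R := Fintype.linearCombination R f
  obtain ⟨m, k, hk⟩ := Submodule.fg_iff_exists_fin_generating_family.mp
    (IsNoetherian.noetherian (LinearMap.ker φ))
  have hkφ (j) : φ (k j) = 0 := by
    rw [← LinearMap.mem_ker, ← hk]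
    exact Submodule.subset_span ⟨j, rfl⟩
  let κ : (Fin l → E) →ₗ[R] (Fin m → E) :=
    LinearMap.pi fun j ↦ ∑ i, k j i • LinearMap.proj i
  let c : CharacterModule (Fin l → E) := ∑ i, dual (LinearMap.proj (R := R) i) (x i)
  have hc_apply (v : Fin l → E) : c v = ∑ i, x i (v i) := by
    simp only [c]
    exact AddMonoidHom.finsetSum_apply _ _ _
  have hc (v : Fin l → E) (hv : κ v = 0) : c v = 0 := by
    let ψ : (Fin l → R) →ₗ[R] E := Fintype.linearCombination R v
    have hψ : LinearMap.ker φ ≤ LinearMap.ker ψ := by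
      rw [← hk, Submodule.span_le]
      rintro _ ⟨j, rfl⟩
      simpa [κ, ψ, Fintype.linearCombination_apply] using congr_fun hv j
    have hinj : Function.Injective ((LinearMap.ker φ).liftQ φ le_rfl) :=
      LinearMap.ker_eq_bot.mp (Submodule.ker_liftQ_eq_bot _ _ _ le_rfl)
    obtain ⟨e, he⟩ := hE.extension_property _ hinj ((LinearMap.ker φ).liftQ ψ hψ)
    have hv' (i) : v i = f i • e 1 := by
      have := congr($he (Submodule.Quotient.mk (Pi.single i 1)))
      simp only [LinearMap.comp_apply, Submodule.liftQ_apply, φ, ψ,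
        Fintype.linearCombination_apply_single, one_smul] at this
      rw [← this, ← map_smul, smul_eq_mul, mul_one]
    have hx' := congr($hx (e 1))
    rw [hc_apply]
    simp only [hv', ← smul_apply]
    exact (AddMonoidHom.finsetSum_apply _ _ _).symm.trans hx'
  obtain ⟨d, hd⟩ := exists_dual_eq_of_ker_le κ c hc
  refine ⟨m, fun i j ↦ k j i, fun j ↦ dual (LinearMap.single R (fun _ ↦ E) j) d,
    fun i ↦ ?_, fun j ↦ ?_⟩
  · ext e
    have h := congr($hd (Pi.single i e))
    rw [hc_apply, Finset.sum_eq_single i (fun j _ hj ↦ by simp [hj]) (by simp)] at h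
    rw [Pi.single_eq_same] at h
    rw [← h]
    refine Eq.trans ?_ (AddMonoidHom.finsetSum_apply _ _ _).symm
    change d _ = ∑ j, d (Pi.single j (k j i • e))
    rw [← map_sum, Finset.univ_sum_single]
    congr 1
    ext j
    simp [κ, Pi.single_apply]
  · simpa [φ, Fintype.linearCombination_apply, mul_comm] using hkφ j

end CharacterModule

/-- Character modules are pure injective. -/
theorem isPureInjective_characterModule (R : Type u) [CommRing R] (M : Type u)
    [AddCommGroup M] [Module R M] : IsPureInjective R (CharacterModule M) := by
  intro A B _ _ _ _ f hf
  exact rTensor_injective_iff_lcomp_surjective.mp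
    ((LinearMap.lTensor_inj_iff_rTensor_inj M f).mp (hf.2 M))

/-- A direct summand of a pure injective module is pure injective. -/
theorem IsPureInjective.of_retract {R : Type u} [CommRing R] {M P : Type u}
    [AddCommGroup M] [Module R M] [AddCommGroup P] [Module R P] (hP : IsPureInjective R P)
    (i : M →ₗ[R] P) (r : P →ₗ[R] M) (hr : r ∘ₗ i = LinearMap.id) : IsPureInjective R M := by
  intro A B _ _ _ _ f hf g
  obtain ⟨h, hh⟩ := hP f hf (i ∘ₗ g)
  exact ⟨r ∘ₗ h, by rw [LinearMap.comp_assoc, hh, ← LinearMap.comp_assoc, hr, LinearMap.id_comp]⟩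

/-- An injective map with flat cokernel is a pure monomorphism. -/
theorem IsPureMono.of_flat_quotient {R : Type u} [CommRing R] {A B : Type u} [AddCommGroup A]
    [AddCommGroup B] [Module R A] [Module R B] (f : A →ₗ[R] B) (hf : Function.Injective f)
    [Module.Flat R (B ⧸ LinearMap.range f)] : IsPureMono f :=
  ⟨hf, fun Q _ _ ↦ LinearMap.lTensor_injective_of_exact_of_flat (LinearMap.range f).mkQ
    (Submodule.mkQ_surjective _) f hf (LinearMap.exact_map_mkQ_range f) Q⟩

/-- Pure injective modules are cotorsion. -/
theorem IsPureInjective.isCotorsion {R : Type u} [CommRing R] {P : Type u}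
    [AddCommGroup P] [Module R P] (hP : IsPureInjective R P) : IsCotorsion R P :=
  fun _ _ _ i hi _ ↦ hP i (.of_flat_quotient i hi) LinearMap.id

/-- Evaluation into the double character module is injective. -/
theorem evalCharacterHom_injective (R : Type u) [CommRing R] (M : Type u)
    [AddCommGroup M] [Module R M] : Function.Injective (evalCharacterHom R M) :=
  (injective_iff_map_eq_zero _).mpr fun _ hm ↦
    CharacterModule.eq_zero_of_character_apply fun c ↦ congr($hm c)

/-- Evaluation on the character module is a section of the dual of evaluation. -/
theorem dual_evalCharacterHom_comp (R : Type u) [CommRing R] (M : Type u)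
    [AddCommGroup M] [Module R M] :
    CharacterModule.dual (evalCharacterHom R M) ∘ₗ evalCharacterHom R (CharacterModule M) =
      LinearMap.id :=
  rfl

/-- If the dual of `f : A → B` has a section and `B` is flat, then the cokernel of `f` is flat. -/
theorem flat_quotient_range_of_dual_section {R A B : Type*} [CommRing R] [AddCommGroup A]
    [AddCommGroup B] [Module R A] [Module R B] [Module.Flat R B] (f : A →ₗ[R] B)
    (s : CharacterModule A →ₗ[R] CharacterModule B)
    (hs : CharacterModule.dual f ∘ₗ s = LinearMap.id) :
    Module.Flat R (B ⧸ LinearMap.range f) := by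
  rw [Module.Flat.iff_characterModule_baer]
  intro I g
  let p := (LinearMap.range f).mkQ
  obtain ⟨h, hh⟩ := Module.Flat.iff_characterModule_baer.mp ‹Module.Flat R B› I
    (CharacterModule.dual p ∘ₗ g)
  let h' : R →ₗ[R] CharacterModule B := h - s ∘ₗ CharacterModule.dual f ∘ₗ h
  have hf' (r : R) : CharacterModule.dual f (h' r) = 0 := by
    simp only [h', LinearMap.sub_apply, map_sub, LinearMap.comp_apply]
    rw [sub_eq_zero]
    exact congr($hs (CharacterModule.dual f (h r))).symm
  obtain ⟨d, hd⟩ := CharacterModule.exists_dual_eq_of_ker_le p (h' 1) fun b hb ↦ by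
    obtain ⟨a, rfl⟩ := (Submodule.Quotient.mk_eq_zero _).mp hb
    exact congr($(hf' 1) a)
  refine ⟨LinearMap.toSpanSingleton R _ d, fun x hx ↦
    CharacterModule.dual_injective_of_surjective p (Submodule.mkQ_surjective _) ?_⟩
  have hfx : CharacterModule.dual f (h x) = 0 := by
    rw [hh x hx]
    ext a
    have hp : p (f a) = 0 := (Submodule.Quotient.mk_eq_zero _).mpr ⟨a, rfl⟩
    change g ⟨x, hx⟩ (p (f a)) = 0
    rw [hp, map_zero]
  rw [LinearMap.toSpanSingleton_apply, map_smul, hd, ← map_smul, smul_eq_mul, mul_one]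
  simp only [h', LinearMap.sub_apply, LinearMap.comp_apply, hfx, map_zero, sub_zero]
  exact hh x hx

/-- Flat cotorsion modules over a noetherian ring are pure injective. -/
theorem IsCotorsion.isPureInjective {R : Type u} [CommRing R] [IsNoetherianRing R] {F : Type u}
    [AddCommGroup F] [Module R F] [hF : Module.Flat R F] (hC : IsCotorsion R F) :
    IsPureInjective R F := by
  have : Module.Flat R (CharacterModule (CharacterModule F)) :=
    CharacterModule.flat_of_baer (Module.Flat.iff_characterModule_baer.mp hF)
  obtain ⟨r, hr⟩ := hC _ (evalCharacterHom R F) (evalCharacterHom_injective R F)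
    (flat_quotient_range_of_dual_section _ _ (dual_evalCharacterHom_comp R F))
  exact (isPureInjective_characterModule R (CharacterModule F)).of_retract _ r hr

/-- Proposition 3.7: over a commutative noetherian ring, a flat module is cotorsion if and
only if it is pure injective. -/
theorem flat_cotorsion_iff_pureInjective
    (R : Type u) [CommRing R] [IsNoetherianRing R]
    (F : Type u) [AddCommGroup F] [Module R F] (hF : Module.Flat R F) :
    IsCotorsion R F ↔ IsPureInjective R F := ⟨IsCotorsion.isPureInjective, IsPureInjective.isCotorsion⟩
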